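/- Let G be a countable group and P ⊆ G a subsemigroup containing the identity e. Then for every F ∈ Ω̃ and every g ∈ G one has F ∈ Ωg if and only if g ∈ F (equivalently, the indicator function of Ωg evaluated at F equals the indicator function of F evaluated at g). -/

import Mathlib

/-! Setup: the Wiener–Hopf space of a subsemigroup `P` (with identity) of a group `G`.
For `x, y ∈ G` we write `x ≤ y` for `y * x⁻¹ ∈ P`.  Subsets of `G` are identified with
their `Bool`-valued indicator functions, giving the power set the topology of pointwise
convergence (product topology on `G → Bool` with `Bool` discrete). -/

/-- `P⁻¹g = {x ∈ G : x ≤ g} = {p⁻¹ * g : p ∈ P}`. -/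
def pinvSet {G : Type*} [Group G] (P : Submonoid G) (g : G) : Set G :=
  {x : G | g * x⁻¹ ∈ P}

/-- The topology of pointwise convergence on the power set of `G`, obtained by
identifying a subset with its `Bool`-valued indicator function. -/
noncomputable def powerSetTopology (G : Type*) : TopologicalSpace (Set G) :=
  TopologicalSpace.induced (fun F : Set G => F.boolIndicator) inferInstance

/-- `Ω := closure {P⁻¹a : a ∈ P}` in the topology of pointwise convergence. -/
noncomputable def whOmega {G : Type*} [Group G] (P : Submonoid G) : Set (Set G) :=
  @closure _ (powerSetTopology G) {F : Set G | ∃ a ∈ P, F = pinvSet P a}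

/-- `Ωg := {Fg : F ∈ Ω}`. -/
noncomputable def whOmegaMul {G : Type*} [Group G] (P : Submonoid G) (g : G) :
    Set (Set G) :=
  {F : Set G | ∃ F₀ ∈ whOmega P, F = (fun x => x * g) '' F₀}

/-- `Ω̃ := ⋃_{g ∈ G} Ωg`. -/
noncomputable def whOmegaTilde {G : Type*} [Group G] (P : Submonoid G) : Set (Set G) :=
  ⋃ g : G, whOmegaMul P g

theorem mem_closure_powerSetTopology_iff {G : Type*} {C : Set (Set G)} {F : Set G} :
    F ∈ @closure _ (powerSetTopology G) C ↔
      ∀ S : Finset G, ∃ E ∈ C, ∀ x ∈ S, x ∈ E ↔ x ∈ F := by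
  classical
  have bool_eq (E : Set G) (x : G) :
      E.boolIndicator x = F.boolIndicator x ↔ (x ∈ E ↔ x ∈ F) := by
    rw [Set.mem_iff_boolIndicator E, Set.mem_iff_boolIndicator F, Bool.eq_iff_iff]
  refine (closure_induced (f := fun F : Set G => F.boolIndicator)).trans ?_
  rw [mem_closure_iff]
  constructor
  · intro h S
    obtain ⟨_, hU, E, hE, rfl⟩ := h ((S : Set G).pi fun x => {F.boolIndicator x})
      (isOpen_set_pi S.finite_toSet fun _ _ => isOpen_discrete _) fun _ _ => rfl
    exact ⟨E, hE, fun x hx => (bool_eq E x).1 (hU x hx)⟩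
  · intro h U hU hFU
    obtain ⟨S, u, hu, hSU⟩ := isOpen_pi_iff.1 hU _ hFU
    obtain ⟨E, hE, hEF⟩ := h S
    refine ⟨E.boolIndicator, hSU fun x hx => ?_, E, hE, rfl⟩
    rw [(bool_eq E x).2 (hEF x hx)]
    exact (hu x hx).2

theorem mem_whOmega_iff {G : Type*} [Group G] {P : Submonoid G} {F : Set G} :
    F ∈ whOmega P ↔ ∀ S : Finset G, ∃ a ∈ P, ∀ x ∈ S, a * x⁻¹ ∈ P ↔ x ∈ F := by
  refine mem_closure_powerSetTopology_iff.trans (forall_congr' fun S => ⟨?_, ?_⟩)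
  · rintro ⟨_, ⟨a, ha, rfl⟩, h⟩
    exact ⟨a, ha, h⟩
  · rintro ⟨a, ha, h⟩
    exact ⟨_, ⟨a, ha, rfl⟩, h⟩

theorem one_mem_of_mem_whOmega {G : Type*} [Group G] {P : Submonoid G} {F : Set G}
    (hF : F ∈ whOmega P) : (1 : G) ∈ F := by
  obtain ⟨a, ha, h⟩ := mem_whOmega_iff.1 hF {1}
  exact (h 1 (Finset.mem_singleton_self 1)).1 (by simpa using ha)

theorem preimage_mul_right_mem_whOmega {G : Type*} [Group G] {P : Submonoid G} {F : Set G}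
    (hF : F ∈ whOmega P) {k : G} (hk : k ∈ F) : (fun x => x * k) ⁻¹' F ∈ whOmega P := by
  classical
  rw [mem_whOmega_iff] at hF ⊢
  intro S
  obtain ⟨a, -, h⟩ := hF (insert k (S.image fun x => x * k))
  refine ⟨a * k⁻¹, (h k (Finset.mem_insert_self _ _)).2 hk, fun x hx => ?_⟩
  have := h (x * k) (Finset.mem_insert_of_mem (Finset.mem_image_of_mem _ hx))
  rwa [mul_inv_rev, ← mul_assoc] at this

/-- Let `G` be a countable group and `P ⊆ G` a subsemigroup containing
the identity.  For every `F ∈ Ω̃` and every `g ∈ G` one has `F ∈ Ωg` if and only if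
`g ∈ F`. -/
theorem mem_whOmegaMul_iff_mem {G : Type*} [Group G] [Countable G] (P : Submonoid G)
    (F : Set G) (hF : F ∈ whOmegaTilde P) (g : G) :
    F ∈ whOmegaMul P g ↔ g ∈ F := by
  constructor
  · rintro ⟨F₀, hF₀, rfl⟩
    exact ⟨1, one_mem_of_mem_whOmega hF₀, one_mul g⟩
  · intro hg
    obtain ⟨h, F₀, hF₀, rfl⟩ := Set.mem_iUnion.1 hF
    obtain ⟨k, hk, rfl⟩ := hg
    refine ⟨_, preimage_mul_right_mem_whOmega hF₀ hk, ?_⟩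
    ext x
    simp [Set.image_mul_right, mul_assoc]
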